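/- Let p ≥ 2 be a natural number, set q := ⌈p/2⌉, let X be a nonempty finite set, and let g : X → Fin 2 → ℝ be a biobjective instance with g j x > 0 for all j and x. Define f : X → Fin p → ℝ by f i x = g 0 x for i < q and f i x = g 1 x for i ≥ q. Let k > q be a natural number, let ε > 0, and let P ⊆ X be a quasi-k-exact (1+ε)-approximation set for (X, f). Then for every solution x' ∈ X that is efficient with respect to g, there exists x ∈ P with g 0 x = g 0 x' and g 1 x = g 1 x'. In particular, the cardinality of P is at least the number of nondominated points of (X, g). -/

import Mathlib

/-- `x` dominates `x'` in the biobjective instance `g`. -/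
def BiDominates {X : Type*} (g : X → Fin 2 → ℝ) (x x' : X) : Prop :=
  (∀ j, g x j ≤ g x' j) ∧ ∃ j, g x j < g x' j

/-- `x` is efficient in the biobjective instance `g`. -/
def BiEfficient {X : Type*} (g : X → Fin 2 → ℝ) (x : X) : Prop :=
  ¬ ∃ x'' : X, BiDominates g x'' x

/-- A set of more than `b - a` indices in `Fin p` contains an index outside `[a, b)`. -/
theorem exists_mem_notMem_Ico_of_lt_ncard {p a b : ℕ} (S : Set (Fin p)) (h : b - a < S.ncard) :
    ∃ i ∈ S, (i : ℕ) ∉ Finset.Ico a b := by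
  by_contra! hS
  have hle : S.ncard ≤ (↑(Finset.Ico a b) : Set ℕ).ncard :=
    Set.ncard_le_ncard_of_injOn Fin.val (fun i hi => Finset.mem_coe.2 (hS i hi))
      Fin.val_injective.injOn (Finset.finite_toSet _)
  rw [Set.ncard_coe_finset, Nat.card_Ico] at hle
  omega

/-- A solution that is no worse than an efficient one in both objectives has the same image. -/
theorem BiEfficient.eq_of_le {X : Type*} {g : X → Fin 2 → ℝ} {x x' : X}
    (h : BiEfficient g x') (hle : g x ≤ g x') : g x = g x' := by
  by_contra hne
  exact h ⟨x, Pi.lt_def.1 (lt_of_le_of_ne hle hne)⟩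

theorem stmt_5 {X : Type*} [Fintype X] [Nonempty X] (p : ℕ) (hp : 2 ≤ p)
    (q : ℕ) (hq : q = (p + 1) / 2)
    (g : X → Fin 2 → ℝ) (hgpos : ∀ (x : X) (j : Fin 2), 0 < g x j)
    (f : X → Fin p → ℝ)
    (hf : ∀ (x : X) (i : Fin p), f x i = if (i : ℕ) < q then g x 0 else g x 1)
    (k : ℕ) (hk : q < k)
    (ε : ℝ) (hε : 0 < ε)
    (P : Finset X)
    (hP : ∀ x' : X, ∃ x ∈ P, (∀ i, f x i ≤ (1 + ε) * f x' i) ∧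
      k ≤ {i : Fin p | f x i ≤ f x' i}.ncard) :
    (∀ x' : X, BiEfficient g x' →
      ∃ x ∈ P, g x 0 = g x' 0 ∧ g x 1 = g x' 1) ∧
    (g '' {x : X | BiEfficient g x}).ncard ≤ P.card := by
  have covered : ∀ x' : X, BiEfficient g x' → ∃ x ∈ P, g x = g x' := by
    intro x' hx'
    obtain ⟨x, hxP, -, hcard⟩ := hP x'
    refine ⟨x, hxP, hx'.eq_of_le ?_⟩
    obtain ⟨i, hi, hiq⟩ := exists_mem_notMem_Ico_of_lt_ncard (a := q) (b := p)
      {i : Fin p | f x i ≤ f x' i} (by omega)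
    obtain ⟨j, hj, hjq⟩ := exists_mem_notMem_Ico_of_lt_ncard (a := 0) (b := q)
      {i : Fin p | f x i ≤ f x' i} (by omega)
    have hi_lt : (i : ℕ) < q := by
      have := i.isLt
      simp only [Finset.mem_Ico] at hiq
      omega
    have hj_ge : ¬ (j : ℕ) < q := by simpa using hjq
    simp only [Set.mem_ofPred_eq, hf, hi_lt, hj_ge, if_true, if_false] at hi hj
    exact Fin.forall_fin_two.2 ⟨hi, hj⟩
  refine ⟨fun x' hx' => ?_, ?_⟩
  · obtain ⟨x, hxP, hx⟩ := covered x' hx'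
    exact ⟨x, hxP, congrFun hx 0, congrFun hx 1⟩
  · have hsub : g '' {x : X | BiEfficient g x} ⊆ g '' (P : Set X) := by
      rintro _ ⟨x', hx', rfl⟩
      exact covered x' hx'
    calc (g '' {x : X | BiEfficient g x}).ncard
        ≤ (g '' (P : Set X)).ncard := Set.ncard_le_ncard hsub (P.finite_toSet.image g)
      _ ≤ (P : Set X).ncard := Set.ncard_image_le P.finite_toSet
      _ = P.card := Set.ncard_coe_finset P
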